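/- For all integers n ≥ 1 and m ≥ 2, the matrix R is invertible and its smallest singular value is at least m − 3/2; equivalently, ‖R⁻¹‖₂ ≤ 1/(m − 3/2). -/

import Mathlib

open Real Finset

/-- `d_ℓ^m` from the Cholesky factor `R`. -/
noncomputable def dd (ℓ m : ℕ) : ℝ :=
  ((ℓ : ℝ) + m - 1) * Real.sqrt (((ℓ : ℝ) + m + 1) * ((ℓ : ℝ) + 2 * m) * ((ℓ : ℝ) + 2 * m + 1) /
    (((ℓ : ℝ) + m) * (2 * (ℓ : ℝ) + 2 * m - 1) * (2 * (ℓ : ℝ) + 2 * m + 1)))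

/-- `e_ℓ^m` from the Cholesky factor `R`. -/
noncomputable def ee (ℓ m : ℕ) : ℝ :=
  Real.sqrt ((ℓ : ℝ) * ((ℓ : ℝ) + 2 * m + 1) / (((ℓ : ℝ) + m) * ((ℓ : ℝ) + m + 1)))

/-- `f_ℓ^m` from the Cholesky factor `R`. -/
noncomputable def ff (ℓ m : ℕ) : ℝ :=
  ((ℓ : ℝ) + m + 2) * Real.sqrt ((ℓ : ℝ) * ((ℓ : ℝ) + 1) * ((ℓ : ℝ) + m) /
    (((ℓ : ℝ) + m + 1) * (2 * (ℓ : ℝ) + 2 * m + 1) * (2 * (ℓ : ℝ) + 2 * m + 3)))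

/-- The `n × n` upper-triangular banded matrix `R` with diagonal `d`, superdiagonal `-e`,
second superdiagonal `-f` (1-based indices shifted to 0-based `Fin n`). -/
noncomputable def Rmat (n m : ℕ) : Matrix (Fin n) (Fin n) ℝ :=
  Matrix.of fun i j : Fin n =>
    if (j : ℕ) = (i : ℕ) then dd ((i : ℕ) + 1) m
    else if (j : ℕ) = (i : ℕ) + 1 then -ee ((i : ℕ) + 1) m
    else if (j : ℕ) = (i : ℕ) + 2 then -ff ((i : ℕ) + 1) m
    else 0

/-- The operator norm on square real matrices induced by the Euclidean norm on `ℝⁿ`. -/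
noncomputable def opNorm2 {n : ℕ} (A : Matrix (Fin n) (Fin n) ℝ) : ℝ :=
  ‖Matrix.toEuclideanCLM (𝕜 := ℝ) A‖

theorem ee_nonneg (ℓ m : ℕ) : 0 ≤ ee ℓ m := Real.sqrt_nonneg _

theorem ff_nonneg (ℓ m : ℕ) : 0 ≤ ff ℓ m := by
  unfold ff
  positivity

theorem ee_le_one {ℓ m : ℕ} (hℓ : 1 ≤ ℓ) : ee ℓ m ≤ 1 := by
  have h : (1 : ℝ) ≤ ℓ := by exact_mod_cast hℓ
  unfold ee
  rw [Real.sqrt_le_iff, one_pow, div_le_one (by positivity)]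
  refine ⟨zero_le_one, ?_⟩
  nlinarith [sq_nonneg (m : ℝ), (Nat.cast_nonneg m : (0 : ℝ) ≤ m)]

theorem ff_le {ℓ m : ℕ} (hℓ : 1 ≤ ℓ) (hm : 2 ≤ m) : ff ℓ m ≤ ((ℓ : ℝ) + 1) / 2 := by
  obtain ⟨a, rfl⟩ := Nat.exists_eq_add_of_le' hm
  obtain ⟨b, rfl⟩ := Nat.exists_eq_add_of_le' hℓ
  refine abs_le_of_sq_le_sq' ?_ (by positivity) |>.2
  unfold ff
  rw [mul_pow, Real.sq_sqrt (by positivity), mul_div_assoc', div_le_iff₀ (by positivity),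
    ← sub_nonneg]
  push_cast
  ring_nf
  positivity

theorem le_dd {ℓ m : ℕ} (hℓ : 1 ≤ ℓ) (hm : 2 ≤ m) : (m : ℝ) + ((ℓ : ℝ) - 1) / 2 ≤ dd ℓ m := by
  obtain ⟨a, rfl⟩ := Nat.exists_eq_add_of_le' hm
  obtain ⟨b, rfl⟩ := Nat.exists_eq_add_of_le' hℓ
  have h1 : (0 : ℝ) < 2 * ((b + 1 : ℕ) : ℝ) + 2 * ((a + 2 : ℕ) : ℝ) - 1 := by
    push_cast
    linarith [(Nat.cast_nonneg a : (0 : ℝ) ≤ a), (Nat.cast_nonneg b : (0 : ℝ) ≤ b)]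
  have h2 : (0 : ℝ) < ((b + 1 : ℕ) : ℝ) + ((a + 2 : ℕ) : ℝ) - 1 := by
    push_cast
    linarith [(Nat.cast_nonneg a : (0 : ℝ) ≤ a), (Nat.cast_nonneg b : (0 : ℝ) ≤ b)]
  refine abs_le_of_sq_le_sq' ?_ (by unfold dd; positivity) |>.2
  unfold dd
  rw [mul_pow, Real.sq_sqrt (by positivity), mul_div_assoc', le_div_iff₀ (by positivity),
    ← sub_nonneg]
  push_cast
  ring_nf
  positivity

theorem sum_ite_le_of_subsingleton {ι : Type*} [Fintype ι] (p : ι → Prop) [DecidablePred p]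
    (hp : ∀ i j, p i → p j → i = j) {a : ℝ} (ha : 0 ≤ a) :
    ∑ i, (if p i then a else 0) ≤ a := by
  rw [← Finset.sum_filter, Finset.sum_const, nsmul_eq_mul]
  have : #{i | p i} ≤ 1 := Finset.card_le_one.2 fun i hi j hj =>
    hp i j (Finset.mem_filter.1 hi).2 (Finset.mem_filter.1 hj).2
  exact mul_le_of_le_one_left ha (by exact_mod_cast this)

/-- A Gershgorin-type bound: if the diagonal of `A` dominates the average of the off-diagonal row
and column sums of `B`, where `B` bounds `|A|` off the diagonal, then `A` is coercive. -/
theorem coercive_of_diag_dominant {ι : Type*} [Fintype ι] [DecidableEq ι] (A B : Matrix ι ι ℝ)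
    (c : ℝ) (hB : ∀ i, B i i = 0) (hAB : ∀ i j, i ≠ j → |A i j| ≤ B i j)
    (hc : ∀ i, c + (∑ j, B i j + ∑ j, B j i) / 2 ≤ A i i) (x : ι → ℝ) :
    c * ∑ i, x i ^ 2 ≤ ∑ i, x i * (A.mulVec x) i := by
  have hterm : ∀ i j, (if i = j then A i i * x i ^ 2 else 0) - B i j * (x i ^ 2 + x j ^ 2) / 2 ≤
      x i * (A i j * x j) := by
    intro i j
    split_ifs with h
    · subst h
      rw [hB]
      exact le_of_eq (by ring)
    · have h1 := abs_le.1 (hAB i j h)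
      nlinarith [mul_nonneg (sub_nonneg.2 h1.2) (sq_nonneg (x i - x j)),
        mul_nonneg (neg_le_iff_add_nonneg.1 h1.1) (sq_nonneg (x i + x j))]
  have hswap : ∑ i, ∑ j, B i j * x j ^ 2 = ∑ i, (∑ j, B j i) * x i ^ 2 := by
    rw [Finset.sum_comm]
    simp only [Finset.sum_mul]
  calc c * ∑ i, x i ^ 2
      ≤ ∑ i, (A i i * x i ^ 2 - ((∑ j, B i j) + ∑ j, B j i) / 2 * x i ^ 2) := by
        rw [Finset.mul_sum]
        refine Finset.sum_le_sum fun i _ => ?_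
        nlinarith [mul_le_mul_of_nonneg_right (hc i) (sq_nonneg (x i))]
    _ = ∑ i, A i i * x i ^ 2 -
          (∑ i, (∑ j, B i j) * x i ^ 2 + ∑ i, (∑ j, B j i) * x i ^ 2) / 2 := by
        rw [Finset.sum_sub_distrib, ← Finset.sum_add_distrib, Finset.sum_div]
        congr 1
        exact Finset.sum_congr rfl fun i _ => by ring
    _ = ∑ i, ∑ j, ((if i = j then A i i * x i ^ 2 else 0) -
          B i j * (x i ^ 2 + x j ^ 2) / 2) := by
        rw [← hswap]
        simp only [Finset.sum_sub_distrib, Finset.sum_ite_eq, Finset.mem_univ, if_true,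
          ← Finset.sum_div, mul_add, Finset.sum_add_distrib, Finset.sum_mul]
    _ ≤ ∑ i, ∑ j, x i * (A i j * x j) :=
        Finset.sum_le_sum fun i _ => Finset.sum_le_sum fun j _ => hterm i j
    _ = ∑ i, x i * (A.mulVec x) i := by
        simp only [Matrix.mulVec, dotProduct, Finset.mul_sum]

theorem Rmat_coercive {n m : ℕ} (hm : 2 ≤ m) (x : Fin n → ℝ) :
    ((m : ℝ) - 3 / 2) * ∑ i, x i ^ 2 ≤ ∑ i, x i * ((Rmat n m).mulVec x) i := by
  refine coercive_of_diag_dominant (Rmat n m) (Matrix.of fun i j : Fin n =>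
    (if (j : ℕ) = i + 1 then (1 : ℝ) else 0) +
      if (j : ℕ) = i + 2 then ((i : ℕ) + 2 : ℝ) / 2 else 0) _ (by simp) ?_ ?_ x
  · intro i j hij
    have hij' : (j : ℕ) ≠ i := fun h => hij (Fin.ext h.symm)
    have he := ee_le_one (m := m) (Nat.le_add_left 1 (i : ℕ))
    have hf := ff_le (Nat.le_add_left 1 (i : ℕ)) hm
    push_cast at hf
    simp only [Rmat, Matrix.of_apply, if_neg hij']
    split_ifs with h1 h2
    · omega
    · rw [abs_neg, abs_of_nonneg (ee_nonneg _ _), add_zero]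
      exact he
    · rw [abs_neg, abs_of_nonneg (ff_nonneg _ _)]
      linarith
    · simp
  · intro i
    have hd := le_dd (Nat.le_add_left 1 (i : ℕ)) hm
    push_cast at hd
    have hcol : ∀ j : Fin n, (if (i : ℕ) = j + 2 then ((j : ℕ) + 2 : ℝ) / 2 else 0) =
        if (i : ℕ) = j + 2 then (i : ℝ) / 2 else 0 := by
      intro j
      split_ifs with h
      · rw [h]
        push_cast
        rfl
      · rfl
    have h1 := sum_ite_le_of_subsingleton (fun j : Fin n => (j : ℕ) = i + 1)
      (by intro a b ha hb; ext; omega) zero_le_one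
    have h2 := sum_ite_le_of_subsingleton (fun j : Fin n => (j : ℕ) = i + 2)
      (by intro a b ha hb; ext; omega) (a := ((i : ℕ) + 2 : ℝ) / 2) (by positivity)
    have h3 := sum_ite_le_of_subsingleton (fun j : Fin n => (i : ℕ) = j + 1)
      (by intro a b ha hb; ext; omega) zero_le_one
    have h4 := sum_ite_le_of_subsingleton (fun j : Fin n => (i : ℕ) = j + 2)
      (by intro a b ha hb; ext; omega) (a := (i : ℝ) / 2) (by positivity)
    simp only [Rmat, Matrix.of_apply, if_true, Finset.sum_add_distrib, hcol]
    linarith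

/-- A coercive real matrix is invertible. -/
theorem isUnit_of_coercive {n : ℕ} {A : Matrix (Fin n) (Fin n) ℝ} {c : ℝ} (hc : 0 < c)
    (h : ∀ x : Fin n → ℝ, c * ∑ i, x i ^ 2 ≤ ∑ i, x i * (A.mulVec x) i) : IsUnit A := by
  rw [← Matrix.mulVec_injective_iff_isUnit]
  refine (injective_iff_map_eq_zero A.mulVecLin).2 fun x hx => ?_
  have hx0 := h x
  rw [Matrix.mulVecLin_apply] at hx
  simp only [hx, Pi.zero_apply, mul_zero, Finset.sum_const_zero] at hx0
  have hsum : ∑ i, x i ^ 2 = 0 :=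
    le_antisymm (by nlinarith) (Finset.sum_nonneg fun i _ => sq_nonneg (x i))
  ext i
  exact pow_eq_zero_iff two_ne_zero |>.1
    ((Finset.sum_eq_zero_iff_of_nonneg fun i _ => sq_nonneg (x i)).1 hsum i (Finset.mem_univ i))

theorem opNorm2_inv_le_of_coercive {n : ℕ} {A : Matrix (Fin n) (Fin n) ℝ} {c : ℝ} (hc : 0 < c)
    (h : ∀ x : Fin n → ℝ, c * ∑ i, x i ^ 2 ≤ ∑ i, x i * (A.mulVec x) i) :
    opNorm2 A⁻¹ ≤ 1 / c := by
  have hA := isUnit_of_coercive hc h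
  refine ContinuousLinearMap.opNorm_le_bound _ (by positivity) fun y => ?_
  set x := Matrix.toEuclideanCLM (𝕜 := ℝ) A⁻¹ y with hx
  have hAx : A.mulVec x = y := by
    rw [hx, Matrix.ofLp_toEuclideanCLM, Matrix.mulVec_mulVec,
      Matrix.mul_nonsing_inv _ ((Matrix.isUnit_iff_isUnit_det A).1 hA), Matrix.one_mulVec]
  have h1 : c * ‖x‖ ^ 2 ≤ ‖x‖ * ‖y‖ := by
    calc c * ‖x‖ ^ 2 = c * ∑ i, x i ^ 2 := by rw [EuclideanSpace.real_norm_sq_eq]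
      _ ≤ ∑ i, x i * y i := by simpa only [hAx] using h x
      _ = inner ℝ y x := by simp [PiLp.inner_apply]
      _ ≤ ‖x‖ * ‖y‖ := by rw [mul_comm]; exact real_inner_le_norm y x
  rw [one_div_mul_eq_div, le_div_iff₀ hc]
  rcases (norm_nonneg x).eq_or_lt with h0 | h0
  · rw [← h0, zero_mul]
    exact norm_nonneg y
  · nlinarith

theorem stmt19 (n m : ℕ) (hn : 1 ≤ n) (hm : 2 ≤ m) :
    IsUnit (Rmat n m) ∧ opNorm2 (Rmat n m)⁻¹ ≤ 1 / ((m : ℝ) - 3 / 2) := by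
  have hc : (0 : ℝ) < (m : ℝ) - 3 / 2 := by
    have : (2 : ℝ) ≤ m := by exact_mod_cast hm
    linarith
  exact ⟨isUnit_of_coercive hc (Rmat_coercive hm), opNorm2_inv_le_of_coercive hc (Rmat_coercive hm)⟩
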